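/- arXiv:1903.02701 — 2 statements merged into one kernel-verified Lean document; each statement's English description precedes it below -/
import Mathlib

section
/- Let n ≥ 2 and let R be an algebraic Kähler curvature tensor on ℂ^n with CQB₁ ≥ 0. Then for every x : Fin n → ℂ one has (n−1) · ‖x‖² · Ric(x,x̄) ≥ ‖x‖² · Ric(x,x̄) − R(x,x̄,x,x̄) ≥ 0; in particular Ric(x,x̄) ≥ 0 for every x (the Ricci curvature is positive semidefinite and dominates 1/(n−1) times the orthogonal Ricci curvature). If moreover CQB₁ > 0, then Ric(x,x̄) > 0 for every nonzero x. (Theorem 2.1 of the paper, pointwise/algebraic form.) -/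
open Finset

/-- An algebraic Kähler curvature tensor on ℂ^n: Kähler symmetries and reality. -/
noncomputable def IsKahlerCurv {n : ℕ} (R : Fin n → Fin n → Fin n → Fin n → ℂ) : Prop :=
  (∀ a b c d, R a b c d = R c b a d) ∧
  (∀ a b c d, R a b c d = R a d c b) ∧
  (∀ a b c d, star (R a b c d) = R b a d c)

/-- The Ricci tensor `Ric a b = ∑ c, R a b c c`. -/
noncomputable def ricT {n : ℕ} (R : Fin n → Fin n → Fin n → Fin n → ℂ) (a b : Fin n) : ℂ :=
  ∑ c, R a b c c

/-- `Ric(x, ȳ)`. -/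
noncomputable def ricForm {n : ℕ} (R : Fin n → Fin n → Fin n → Fin n → ℂ) (x y : Fin n → ℂ) : ℂ :=
  ∑ a, ∑ b, ricT R a b * x a * star (y b)

/-- The bisectional curvature `R(x, x̄, y, ȳ)`. -/
noncomputable def bisec {n : ℕ} (R : Fin n → Fin n → Fin n → Fin n → ℂ) (x y : Fin n → ℂ) : ℂ :=
  ∑ a, ∑ b, ∑ c, ∑ d, R a b c d * x a * star (x b) * y c * star (y d)

/-- `‖x‖²`. -/
noncomputable def norm2 {n : ℕ} (x : Fin n → ℂ) : ℝ := ∑ a, ‖x a‖ ^ 2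

/-- The cross quadratic bisectional curvature quadratic form on matrices. -/
noncomputable def CQB {n : ℕ} (R : Fin n → Fin n → Fin n → Fin n → ℂ)
    (A : Matrix (Fin n) (Fin n) ℂ) : ℝ :=
  ((∑ a, ∑ b, ∑ c, ricT R a b * A c a * star (A c b)) -
    (∑ a, ∑ b, ∑ c, ∑ d, R a b c d * A a c * star (A b d))).re

open scoped ComplexOrder Matrix

/-- A positive semidefinite form is bounded by its trace. -/
lemma Matrix.PosSemidef.re_star_dotProduct_mulVec_le {n : ℕ} {M : Matrix (Fin n) (Fin n) ℂ}
    (hM : M.PosSemidef) (x : Fin n → ℂ) :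
    (star x ⬝ᵥ M *ᵥ x).re ≤ M.trace.re * norm2 x := by
  obtain ⟨m, v, rfl⟩ := Matrix.posSemidef_iff_eq_sum_vecMulVec.mp hM
  have htr : (∑ i, Matrix.vecMulVec (v i) (star (v i))).trace.re = ∑ i, norm2 (v i) := by
    simp [Matrix.trace_sum, Matrix.trace_vecMulVec, dotProduct, norm2, Complex.sq_norm,
      Complex.normSq_apply]
  rw [htr, Matrix.sum_mulVec, dotProduct_sum, Complex.re_sum, sum_mul]
  refine sum_le_sum fun i _ => ?_
  have hval : (star x ⬝ᵥ Matrix.vecMulVec (v i) (star (v i)) *ᵥ x).re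
      = ‖∑ a, star (v i a) * x a‖ ^ 2 := by
    rw [Matrix.vecMulVec_mulVec]
    simp only [op_smul_eq_smul, dotProduct_smul, smul_eq_mul]
    rw [Matrix.star_dotProduct x, Complex.star_def, Complex.mul_conj, Complex.ofReal_re,
      Complex.normSq_eq_norm_sq]
    rfl
  rw [hval]
  calc ‖∑ a, star (v i a) * x a‖ ^ 2 ≤ (∑ a, ‖v i a‖ * ‖x a‖) ^ 2 := by
        gcongr
        refine (norm_sum_le _ _).trans_eq ?_
        simp
    _ ≤ norm2 (v i) * norm2 x := sum_mul_sq_le_sq_mul_sq _ _ _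

lemma re_star_dotProduct_self {n : ℕ} (x : Fin n → ℂ) : (star x ⬝ᵥ x).re = norm2 x := by
  simp [dotProduct, norm2, Complex.sq_norm, Complex.normSq_apply]

/-- The Hermitian matrix of `p ↦ R(p, p̄, q, q̄)`. -/
noncomputable def bisecMatrix {n : ℕ} (R : Fin n → Fin n → Fin n → Fin n → ℂ) (q : Fin n → ℂ) :
    Matrix (Fin n) (Fin n) ℂ :=
  Matrix.of fun b a => ∑ c, ∑ d, R a b c d * q c * star (q d)

/-- The Hermitian matrix of `p ↦ ‖p‖² Ric(q, q̄) - R(p, p̄, q, q̄)`. -/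
noncomputable def cqbMatrix {n : ℕ} (R : Fin n → Fin n → Fin n → Fin n → ℂ) (q : Fin n → ℂ) :
    Matrix (Fin n) (Fin n) ℂ :=
  (ricForm R q q).re • 1 - bisecMatrix R q

section

variable {n : ℕ} {R : Fin n → Fin n → Fin n → Fin n → ℂ}

lemma star_dotProduct_bisecMatrix (p q : Fin n → ℂ) :
    star p ⬝ᵥ bisecMatrix R q *ᵥ p = bisec R p q := by
  simp only [dotProduct, Matrix.mulVec, bisecMatrix, Matrix.of_apply, bisec, mul_sum, sum_mul,
    Pi.star_apply]
  rw [sum_comm]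
  refine sum_congr rfl fun a _ => sum_congr rfl fun b _ => sum_congr rfl fun c _ =>
    sum_congr rfl fun d _ => ?_
  ring

lemma re_star_dotProduct_cqbMatrix (p q : Fin n → ℂ) :
    (star p ⬝ᵥ cqbMatrix R q *ᵥ p).re = norm2 p * (ricForm R q q).re - (bisec R p q).re := by
  rw [cqbMatrix, Matrix.sub_mulVec, dotProduct_sub, star_dotProduct_bisecMatrix,
    Matrix.smul_mulVec, Matrix.one_mulVec, dotProduct_smul, Complex.sub_re, Complex.smul_re,
    re_star_dotProduct_self, smul_eq_mul, mul_comm]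

lemma CQB_vecMulVec (p q : Fin n → ℂ) :
    CQB R (Matrix.vecMulVec p q) = norm2 p * (ricForm R q q).re - (bisec R p q).re := by
  have hric : ∑ a, ∑ b, ∑ c, ricT R a b * Matrix.vecMulVec p q c a *
      star (Matrix.vecMulVec p q c b) = (norm2 p : ℂ) * ricForm R q q := by
    simp only [norm2, ricForm, Complex.ofReal_sum, mul_sum]
    refine sum_congr rfl fun a _ => sum_congr rfl fun b _ => ?_
    rw [sum_mul]
    refine sum_congr rfl fun c _ => ?_
    rw [Complex.ofReal_pow, ← Complex.mul_conj', Matrix.vecMulVec_apply, Matrix.vecMulVec_apply,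
      star_mul', Complex.star_def]
    ring
  have hbisec : ∑ a, ∑ b, ∑ c, ∑ d, R a b c d * Matrix.vecMulVec p q a c *
      star (Matrix.vecMulVec p q b d) = bisec R p q := by
    refine sum_congr rfl fun a _ => sum_congr rfl fun b _ => sum_congr rfl fun c _ =>
      sum_congr rfl fun d _ => ?_
    rw [Matrix.vecMulVec_apply, Matrix.vecMulVec_apply, star_mul']
    ring
  rw [CQB, hric, hbisec, Complex.sub_re, Complex.re_ofReal_mul]

lemma IsKahlerCurv.isHermitian_bisecMatrix (hR : IsKahlerCurv R) (q : Fin n → ℂ) :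
    (bisecMatrix R q).IsHermitian := by
  ext a b
  simp only [bisecMatrix, Matrix.conjTranspose_apply, Matrix.of_apply, star_sum, star_mul',
    star_star, hR.2.2]
  rw [sum_comm]
  refine sum_congr rfl fun c _ => sum_congr rfl fun d _ => ?_
  ring

lemma IsKahlerCurv.trace_bisecMatrix (hR : IsKahlerCurv R) (q : Fin n → ℂ) :
    (bisecMatrix R q).trace = ricForm R q q := by
  simp only [Matrix.trace, Matrix.diag_apply, bisecMatrix, Matrix.of_apply, ricForm, ricT, sum_mul]
  rw [sum_comm]
  refine sum_congr rfl fun c _ => ?_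
  rw [sum_comm]
  refine sum_congr rfl fun d _ => sum_congr rfl fun a _ => ?_
  rw [hR.1 a a c d, hR.2.1 c a a d]

lemma IsKahlerCurv.re_trace_cqbMatrix (hR : IsKahlerCurv R) (q : Fin n → ℂ) :
    (cqbMatrix R q).trace.re = ((n : ℝ) - 1) * (ricForm R q q).re := by
  rw [cqbMatrix, Matrix.trace_sub, Matrix.trace_smul, Matrix.trace_one, Complex.sub_re,
    Complex.smul_re, hR.trace_bisecMatrix, Fintype.card_fin, Complex.natCast_re, smul_eq_mul]
  ring

lemma IsKahlerCurv.posSemidef_cqbMatrix (hR : IsKahlerCurv R)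
    (hCQB : ∀ A : Matrix (Fin n) (Fin n) ℂ, A.rank ≤ 1 → 0 ≤ CQB R A) (q : Fin n → ℂ) :
    (cqbMatrix R q).PosSemidef := by
  have hH : (cqbMatrix R q).IsHermitian :=
    (Matrix.isHermitian_one.smul (IsSelfAdjoint.all _)).sub (hR.isHermitian_bisecMatrix q)
  refine .of_dotProduct_mulVec_nonneg hH fun p => Complex.nonneg_iff.mpr
    ⟨?_, (hH.im_star_dotProduct_mulVec_self p).symm⟩
  rw [re_star_dotProduct_cqbMatrix, ← CQB_vecMulVec]
  exact hCQB _ (Matrix.rank_vecMulVec_le p q)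

end

/-- Theorem 2.1: if `CQB₁ ≥ 0` then
`(n−1)·‖x‖²·Ric(x,x̄) ≥ ‖x‖²·Ric(x,x̄) − R(x,x̄,x,x̄) ≥ 0`, in particular `Ric ≥ 0`;
and if `CQB₁ > 0` then `Ric > 0` on nonzero vectors. -/
theorem ric_nonneg_of_cqb_one_nonneg (n : ℕ) (hn : 2 ≤ n)
    (R : Fin n → Fin n → Fin n → Fin n → ℂ) (hR : IsKahlerCurv R)
    (hCQB : ∀ A : Matrix (Fin n) (Fin n) ℂ, A.rank ≤ 1 → 0 ≤ CQB R A) :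
    (∀ x : Fin n → ℂ,
      ((n : ℝ) - 1) * norm2 x * (ricForm R x x).re ≥
        norm2 x * (ricForm R x x).re - (bisec R x x).re ∧
      norm2 x * (ricForm R x x).re - (bisec R x x).re ≥ 0 ∧
      0 ≤ (ricForm R x x).re) ∧
    ((∀ A : Matrix (Fin n) (Fin n) ℂ, A ≠ 0 → A.rank ≤ 1 → 0 < CQB R A) →
      ∀ x : Fin n → ℂ, x ≠ 0 → 0 < (ricForm R x x).re) := by
  have hn' : (0 : ℝ) < (n : ℝ) - 1 := by
    have : (2 : ℝ) ≤ n := by exact_mod_cast hn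
    linarith
  have hupper (x : Fin n → ℂ) : norm2 x * (ricForm R x x).re - (bisec R x x).re ≤
      ((n : ℝ) - 1) * norm2 x * (ricForm R x x).re := by
    have h := (hR.posSemidef_cqbMatrix hCQB x).re_star_dotProduct_mulVec_le x
    rw [re_star_dotProduct_cqbMatrix, hR.re_trace_cqbMatrix] at h
    linarith
  have hnonneg (x : Fin n → ℂ) : 0 ≤ (ricForm R x x).re := by
    have h := (Complex.nonneg_iff.mp (hR.posSemidef_cqbMatrix hCQB x).trace_nonneg).1
    rw [hR.re_trace_cqbMatrix] at h
    exact nonneg_of_mul_nonneg_right h hn'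
  refine ⟨fun x => ⟨hupper x, ?_, hnonneg x⟩, fun hpos x hx => (hnonneg x).lt_of_ne fun h0 => ?_⟩
  · rw [← CQB_vecMulVec]
    exact hCQB _ (Matrix.rank_vecMulVec_le x x)
  · have h := hpos (Matrix.vecMulVec x x) (by simp [Matrix.vecMulVec_eq_zero, hx])
      (Matrix.rank_vecMulVec_le x x)
    rw [CQB_vecMulVec] at h
    have h' := h.trans_le (hupper x)
    rw [← h0, mul_zero] at h'
    exact lt_irrefl _ h'
end

section
/- Let n ≥ 1 and let R be an algebraic Kähler curvature tensor on ℂ^n. Then ᵈCQB₁ ≥ 0 holds if and only if for all vectors x, y : Fin n → ℂ one has ‖x‖² · Ric(y,ȳ) + R(x,x̄,y,ȳ) ≥ 0. Moreover, if ᵈCQB₁ > 0 then ‖x‖² · Ric(y,ȳ) + R(x,x̄,y,ȳ) > 0 whenever x and y are both nonzero. (Part of Theorem 2.6 of the paper, pointwise/algebraic form.) -/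
open Finset

/-- The dual cross quadratic bisectional curvature quadratic form on matrices. -/
noncomputable def dCQB {n : ℕ} (R : Fin n → Fin n → Fin n → Fin n → ℂ)
    (A : Matrix (Fin n) (Fin n) ℂ) : ℝ :=
  ((∑ a, ∑ c, ∑ d, ricT R c d * star (A c a) * A d a) +
    (∑ a, ∑ b, ∑ c, ∑ d, R a b c d * star (A c a) * A d b)).re

theorem Matrix.exists_eq_vecMulVec_of_rank_le_one {K m n : Type*} [Field K] [Finite m] [Fintype n]
    (A : Matrix m n K) (hA : A.rank ≤ 1) : ∃ u v, A = Matrix.vecMulVec u v := by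
  rw [Matrix.rank_eq_finrank_span_cols, finrank_le_one_iff] at hA
  obtain ⟨u, hu⟩ := hA
  choose v hv using fun j => hu ⟨A.col j, Submodule.subset_span ⟨j, rfl⟩⟩
  refine ⟨u, v, ?_⟩
  ext i j
  have h := congrFun (congrArg Subtype.val (hv j)) i
  simpa [Matrix.vecMulVec_apply, mul_comm] using h.symm

theorem norm2_eq_sum_star_mul {n : ℕ} (x : Fin n → ℂ) :
    (norm2 x : ℂ) = ∑ a, star (x a) * x a := by
  simp [norm2, Complex.conj_mul']

theorem dCQB_vecMulVec_star {n : ℕ} (R : Fin n → Fin n → Fin n → Fin n → ℂ)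
    (x y : Fin n → ℂ) :
    dCQB R (Matrix.vecMulVec (star y) (star x)) =
      norm2 x * (ricForm R y y).re + (bisec R x y).re := by
  rw [← Complex.re_ofReal_mul, ← Complex.add_re, norm2_eq_sum_star_mul]
  unfold dCQB ricForm bisec
  congr 2
  · rw [Finset.sum_mul]
    simp only [Finset.mul_sum]
    refine Finset.sum_congr rfl fun a _ => Finset.sum_congr rfl fun c _ =>
      Finset.sum_congr rfl fun d _ => ?_
    simp only [Matrix.vecMulVec_apply, Pi.star_apply, star_mul, star_star]
    ring
  · refine Finset.sum_congr rfl fun a _ => Finset.sum_congr rfl fun b _ =>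
      Finset.sum_congr rfl fun c _ => Finset.sum_congr rfl fun d _ => ?_
    simp only [Matrix.vecMulVec_apply, Pi.star_apply, star_mul, star_star]
    ring

/-- Theorem 2.6 (part): `ᵈCQB₁ ≥ 0` iff `‖x‖²·Ric(y,ȳ) + R(x,x̄,y,ȳ) ≥ 0` for all `x, y`;
and if `ᵈCQB₁ > 0` then the strict inequality holds for nonzero `x, y`. -/
theorem dcqb_one_nonneg_iff (n : ℕ) (hn : 1 ≤ n)
    (R : Fin n → Fin n → Fin n → Fin n → ℂ) (hR : IsKahlerCurv R) :
    ((∀ A : Matrix (Fin n) (Fin n) ℂ, A.rank ≤ 1 → 0 ≤ dCQB R A) ↔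
      (∀ x y : Fin n → ℂ, 0 ≤ norm2 x * (ricForm R y y).re + (bisec R x y).re)) ∧
    ((∀ A : Matrix (Fin n) (Fin n) ℂ, A ≠ 0 → A.rank ≤ 1 → 0 < dCQB R A) →
      (∀ x y : Fin n → ℂ, x ≠ 0 → y ≠ 0 →
        0 < norm2 x * (ricForm R y y).re + (bisec R x y).re)) := by
  refine ⟨⟨fun h x y => ?_, fun h A hA => ?_⟩, fun h x y hx hy => ?_⟩
  · rw [← dCQB_vecMulVec_star]
    exact h _ (Matrix.rank_vecMulVec_le _ _)
  · obtain ⟨u, v, rfl⟩ := A.exists_eq_vecMulVec_of_rank_le_one hA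
    simpa only [← dCQB_vecMulVec_star, star_star] using h (star v) (star u)
  · rw [← dCQB_vecMulVec_star]
    exact h _ (Matrix.vecMulVec_ne_zero (star_ne_zero.mpr hy) (star_ne_zero.mpr hx))
      (Matrix.rank_vecMulVec_le _ _)
end
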